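/- arXiv:2304.00241 — 3 statements merged into one kernel-verified Lean document; each statement's English description precedes it below -/
import Mathlib

section
/- Let V = U₁ Σ U₂ᵀ be as in the SVD setup with c ≥ 2, let K be a positive integer, set S(t) = ∑_{j=1}^c σ_j^{4K} t_j², and for t ∈ ℝ^c define the matrix P̃(t) = U₂ Σ^{2K} (t tᵀ) Σ^{2K} U₂ᵀ / S(t) (set to the zero matrix when S(t) = 0). Then the Bochner integral of t ↦ V · P̃(t) with respect to γ equals U₁ · diag(σ₁ w₁, …, σ_c w_c) · U₂ᵀ, where w_k = ∫ σ_k^{4K} t_k² / S(t) dγ(t). -/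
open Matrix MeasureTheory ProbabilityTheory

attribute [local instance] Matrix.normedAddCommGroup Matrix.normedSpace

lemma aux_flip (c : ℕ) (i : Fin c) :
    MeasurePreserving (fun (t : Fin c → ℝ) (k : Fin c) => if k = i then - t k else t k)
      (Measure.pi fun _ : Fin c => gaussianReal 0 1)
      (Measure.pi fun _ : Fin c => gaussianReal 0 1) := by
  refine measurePreserving_pi (f := fun k x => if k = i then -x else x) _ _ ?_
  intro k
  by_cases h : k = i
  · simp only [h, if_true]
    refine ⟨measurable_neg, ?_⟩
    have := gaussianReal_map_neg (μ := 0) (v := 1)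
    simpa using this
  · simp only [h, if_false]
    exact MeasurePreserving.id _

lemma aux_flip_emb (c : ℕ) (i : Fin c) :
    MeasurableEmbedding (fun (t : Fin c → ℝ) (k : Fin c) => if k = i then - t k else t k) := by
  have hm := (aux_flip c i).measurable
  have hinv : Function.Involutive
      (fun (t : Fin c → ℝ) (k : Fin c) => if k = i then - t k else t k) := by
    intro t
    funext k
    by_cases h : k = i <;> simp [h]
  exact (MeasurableEquiv.mk hinv.toPerm hm hm).measurableEmbedding

lemma aux_zero (c : ℕ) (i j : Fin c) (hij : i ≠ j) (f : (Fin c → ℝ) → ℝ)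
    (hf : ∀ t, f (fun k : Fin c => if k = i then - t k else t k) = - f t) :
    ∫ t, f t ∂(Measure.pi fun _ : Fin c => gaussianReal 0 1) = 0 := by
  have h := (aux_flip c i).integral_comp (aux_flip_emb c i) f
  simp only [hf, integral_neg] at h
  linarith

theorem expected_projected_matrix (n c : ℕ) (hn : 0 < n) (hc : 2 ≤ c)
    (V U₁ : Matrix (Fin n) (Fin c) ℝ) (U₂ : Matrix (Fin c) (Fin c) ℝ)
    (σ : Fin c → ℝ) (hσ : ∀ j, 0 < σ j)
    (hU₁ : U₁ᵀ * U₁ = 1) (hU₂ : U₂ᵀ * U₂ = 1) (hU₂' : U₂ * U₂ᵀ = 1)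
    (hV : V = U₁ * Matrix.diagonal σ * U₂ᵀ)
    (K : ℕ) (hK : 0 < K)
    (S : (Fin c → ℝ) → ℝ) (hS : ∀ t, S t = ∑ j, σ j ^ (4 * K) * t j ^ 2)
    (P : (Fin c → ℝ) → Matrix (Fin c) (Fin c) ℝ)
    (hP : ∀ t, P t = (S t)⁻¹ •
      (U₂ * Matrix.diagonal (fun j => σ j ^ (2 * K)) * Matrix.vecMulVec t t *
        Matrix.diagonal (fun j => σ j ^ (2 * K)) * U₂ᵀ))
    (w : Fin c → ℝ)
    (hw : ∀ k, w k = ∫ t : Fin c → ℝ, σ k ^ (4 * K) * t k ^ 2 / S t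
        ∂(Measure.pi fun _ : Fin c => gaussianReal 0 1)) :
    ∫ t : Fin c → ℝ, V * P t ∂(Measure.pi fun _ : Fin c => gaussianReal 0 1) =
      U₁ * Matrix.diagonal (fun k => σ k * w k) * U₂ᵀ := by
  have hS' : ∀ t, S t = ∑ j, (σ j ^ (2 * K) * t j) ^ 2 := by
    intro t
    rw [hS]
    refine Finset.sum_congr rfl fun j _ => ?_
    ring
  set M : Fin c → Fin c → (Fin c → ℝ) → ℝ := fun i j t =>
    (S t)⁻¹ * ((σ i ^ (2 * K) * t i) * (σ j ^ (2 * K) * t j)) with hM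
  set A : Fin c → Fin c → Matrix (Fin n) (Fin c) ℝ := fun i j =>
    Matrix.of fun a b => U₁ a i * σ i * U₂ b j with hA
  have hSm : Measurable S := by
    rw [show S = fun t => ∑ j, (σ j ^ (2 * K) * t j) ^ 2 from funext hS']
    fun_prop
  have hMi : ∀ i j, Integrable (M i j) (Measure.pi fun _ : Fin c => gaussianReal 0 1) := by
    intro i j
    refine Integrable.of_bound (C := 1) ?_ ?_
    · apply Measurable.aestronglyMeasurable
      simp only [hM]
      fun_prop
    · refine Filter.Eventually.of_forall fun t => ?_
      have h0 : 0 ≤ S t := by rw [hS']; positivity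
      have hi : ∀ i, (σ i ^ (2 * K) * t i) ^ 2 ≤ S t := by
        intro i
        rw [hS']
        exact Finset.single_le_sum (f := fun j => (σ j ^ (2 * K) * t j) ^ 2)
          (fun _ _ => sq_nonneg _) (Finset.mem_univ i)
      have h1 : |(σ i ^ (2 * K) * t i) * (σ j ^ (2 * K) * t j)| ≤ S t := by
        have a := hi i
        have b := hi j
        generalize σ i ^ (2 * K) * t i = x at *
        generalize σ j ^ (2 * K) * t j = y at *
        rw [abs_le]
        constructor <;> nlinarith [sq_nonneg (x - y), sq_nonneg (x + y)]
      simp only [hM]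
      rw [Real.norm_eq_abs, abs_mul, abs_inv, abs_of_nonneg h0]
      calc (S t)⁻¹ * _ ≤ (S t)⁻¹ * S t := by gcongr
        _ ≤ 1 := inv_mul_le_one
  have hVP : ∀ t, V * P t = ∑ i, ∑ j, M i j t • A i j := by
    intro t
    have e : V * P t = (S t)⁻¹ • (U₁ * (Matrix.diagonal σ * Matrix.diagonal (fun j => σ j ^ (2 * K))
        * Matrix.vecMulVec t t * Matrix.diagonal (fun j => σ j ^ (2 * K))) * U₂ᵀ) := by
      rw [hP, hV, Matrix.mul_smul]
      congr 1
      simp only [Matrix.mul_assoc]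
      rw [← Matrix.mul_assoc U₂ᵀ U₂, hU₂, Matrix.one_mul]
    rw [e]
    ext a b
    simp only [Matrix.smul_apply, Matrix.sum_apply, hA, hM, Matrix.of_apply, smul_eq_mul]
    rw [Matrix.mul_apply, Finset.mul_sum, Finset.sum_comm]
    refine Finset.sum_congr rfl fun j _ => ?_
    rw [Matrix.mul_apply, Finset.sum_mul, Finset.mul_sum]
    refine Finset.sum_congr rfl fun i _ => ?_
    rw [Matrix.mul_diagonal, Matrix.diagonal_mul_diagonal, Matrix.diagonal_mul,
      Matrix.vecMulVec_apply, Matrix.transpose_apply]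
    ring
  have hoff : ∀ i j, ∫ t, M i j t ∂(Measure.pi fun _ : Fin c => gaussianReal 0 1)
      = if i = j then w i else 0 := by
    intro i j
    by_cases h : i = j
    · subst h
      rw [if_pos rfl, hw]
      congr 1
      funext t
      simp only [hM]
      ring
    · rw [if_neg h]
      refine aux_zero c i j h _ fun t => ?_
      have hs : S (fun k : Fin c => if k = i then - t k else t k) = S t := by
        rw [hS, hS]
        refine Finset.sum_congr rfl fun k _ => ?_
        by_cases hk : k = i <;> simp [hk]
      simp only [hM, hs, if_true, if_neg (Ne.symm h)]
      ring
  simp only [hVP]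
  rw [integral_finset_sum _ fun i _ => integrable_finset_sum _ fun j _ => (hMi i j).smul_const _]
  have : ∀ i, ∫ t, ∑ j, M i j t • A i j ∂(Measure.pi fun _ : Fin c => gaussianReal 0 1)
      = w i • A i i := by
    intro i
    rw [integral_finset_sum _ fun j _ => (hMi i j).smul_const _]
    simp only [integral_smul_const, hoff, ite_smul, zero_smul]
    simp
  simp only [this]
  ext a b
  rw [Matrix.mul_apply]
  simp only [Matrix.sum_apply, Matrix.smul_apply, hA, Matrix.of_apply, Matrix.mul_diagonal,
    Matrix.transpose_apply, smul_eq_mul]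
  refine Finset.sum_congr rfl fun i _ => ?_
  ring
end

section
/- (Feature Dispersion, Theorem 1.) Let V = U₁ Σ U₂ᵀ be as in the SVD setup with c ≥ 2, let K be a positive integer, let ε ∈ (0,1), set S(t) = ∑_{j=1}^c σ_j^{4K} t_j², and for t ∈ ℝ^c define P̃(t) = U₂ Σ^{2K} (t tᵀ) Σ^{2K} U₂ᵀ / S(t) (set to the zero matrix when S(t) = 0). Then the expected feature-dispersed matrix satisfies ∫ V (I − ε P̃(t)) dγ(t) = U₁ Σ Σ_μ U₂ᵀ, where Σ_μ = diag(μ₁, …, μ_c) and μ_k = 1 − ε ∫ σ_k^{4K} t_k² / S(t) dγ(t). -/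
open Matrix MeasureTheory ProbabilityTheory

attribute [local instance] Matrix.normedAddCommGroup Matrix.normedSpace

lemma fd_neg : Measure.map (fun x : ℝ => -x) (gaussianReal 0 1) = gaussianReal 0 1 := by
  rw [gaussianReal_map_neg]; simp

lemma fd_off {c : ℕ} (F : (Fin c → ℝ) → ℝ) (hF : Measurable F) (i : Fin c)
    (hodd : ∀ t, F (fun k => if k = i then - t k else t k) = - F t) :
    ∫ t, F t ∂(Measure.pi fun _ : Fin c => gaussianReal 0 1) = 0 := by
  have hp : MeasurePreserving (fun (t : Fin c → ℝ) k => (if k = i then (fun x : ℝ => -x) else id) (t k))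
      (Measure.pi fun _ : Fin c => gaussianReal 0 1)
      (Measure.pi fun _ : Fin c => gaussianReal 0 1) := by
    refine measurePreserving_pi (fun _ : Fin c => gaussianReal 0 1) (fun _ : Fin c => gaussianReal 0 1) (f := fun k => if k = i then (fun x : ℝ => -x) else id) ?_
    intro k
    by_cases hk : k = i
    · simp only [hk, if_true]
      exact ⟨measurable_neg, fd_neg⟩
    · simp only [hk, if_false]
      exact MeasurePreserving.id _
  have h1 : ∫ t, F t ∂(Measure.pi fun _ : Fin c => gaussianReal 0 1) =
      ∫ t, - F t ∂(Measure.pi fun _ : Fin c => gaussianReal 0 1) := by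
    conv_lhs => rw [← hp.map_eq]
    rw [integral_map hp.measurable.aemeasurable hF.aestronglyMeasurable]
    congr 1
    ext t
    rw [← hodd]
    congr 1
    ext k
    by_cases hk : k = i <;> simp [hk]
  rw [integral_neg] at h1
  linarith

lemma fd_gen {E : Type*} [NormedAddCommGroup E] [NormedSpace ℝ E] [CompleteSpace E] {c : ℕ}
    {Ω : Type*} [MeasurableSpace Ω] (γ : Measure Ω) [IsProbabilityMeasure γ]
    (m : Fin c → Fin c → Ω → ℝ) (hmi : ∀ i j, Integrable (m i j) γ) (V : E) (B : Fin c → Fin c → E) :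
    ∫ t, (V - ∑ i, ∑ j, m i j t • B i j) ∂γ = V - ∑ i, ∑ j, (∫ t, m i j t ∂γ) • B i j := by
  have hBi : ∀ i j, Integrable (fun t => m i j t • B i j) γ := fun i j => (hmi i j).smul_const _
  rw [integral_sub (integrable_const _)
    (integrable_finsetSum _ fun i _ => integrable_finsetSum _ fun j _ => hBi i j),
    integral_finsetSum _ (fun i _ => integrable_finsetSum _ fun j _ => hBi i j)]
  simp only [integral_const, probReal_univ, one_smul]
  congr 1
  refine Finset.sum_congr rfl fun i _ => ?_
  rw [integral_finsetSum _ (fun j _ => hBi i j)]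
  simp only [integral_smul_const]

/-- Feature Dispersion (Theorem 1). -/
theorem feature_dispersion (n c : ℕ) (hn : 0 < n) (hc : 2 ≤ c)
    (V U₁ : Matrix (Fin n) (Fin c) ℝ) (U₂ : Matrix (Fin c) (Fin c) ℝ)
    (σ : Fin c → ℝ) (hσ : ∀ j, 0 < σ j)
    (hU₁ : U₁ᵀ * U₁ = 1) (hU₂ : U₂ᵀ * U₂ = 1) (hU₂' : U₂ * U₂ᵀ = 1)
    (hV : V = U₁ * Matrix.diagonal σ * U₂ᵀ)
    (K : ℕ) (hK : 0 < K) (ε : ℝ) (hε : ε ∈ Set.Ioo (0 : ℝ) 1)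
    (S : (Fin c → ℝ) → ℝ) (hS : ∀ t, S t = ∑ j, σ j ^ (4 * K) * t j ^ 2)
    (P : (Fin c → ℝ) → Matrix (Fin c) (Fin c) ℝ)
    (hP : ∀ t, P t = (S t)⁻¹ •
      (U₂ * Matrix.diagonal (fun j => σ j ^ (2 * K)) * Matrix.vecMulVec t t *
        Matrix.diagonal (fun j => σ j ^ (2 * K)) * U₂ᵀ))
    (μ : Fin c → ℝ)
    (hμ : ∀ k, μ k = 1 - ε * ∫ t : Fin c → ℝ, σ k ^ (4 * K) * t k ^ 2 / S t
        ∂(Measure.pi fun _ : Fin c => gaussianReal 0 1)) :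
    ∫ t : Fin c → ℝ, V * (1 - ε • P t)
        ∂(Measure.pi fun _ : Fin c => gaussianReal 0 1) =
      U₁ * Matrix.diagonal σ * Matrix.diagonal μ * U₂ᵀ := by
  set γ := (Measure.pi fun _ : Fin c => gaussianReal 0 1) with hγ
  have hSm : Measurable S := by
    have : S = fun t => ∑ j, σ j ^ (4 * K) * t j ^ 2 := funext hS
    rw [this]; fun_prop
  let m : Fin c → Fin c → (Fin c → ℝ) → ℝ := fun i j t =>
    (S t)⁻¹ * ((σ i ^ (2 * K) * t i) * (σ j ^ (2 * K) * t j))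
  have hmm : ∀ i j, Measurable (m i j) := by
    intro i j
    exact hSm.inv.mul (by fun_prop)
  have hsq : ∀ (t : Fin c → ℝ) (k : Fin c), (σ k ^ (2 * K) * t k) ^ 2 = σ k ^ (4 * K) * t k ^ 2 := by
    intro t k; rw [mul_pow, ← pow_mul]; congr 2; ring
  have hS0 : ∀ t, 0 ≤ S t := by
    intro t; rw [hS]
    exact Finset.sum_nonneg fun k _ => by rw [← hsq]; positivity
  have hle : ∀ t k, (σ k ^ (2 * K) * t k) ^ 2 ≤ S t := by
    intro t k
    rw [hS, hsq]
    exact Finset.single_le_sum (f := fun k => σ k ^ (4 * K) * t k ^ 2)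
      (fun k _ => by rw [← hsq]; positivity) (Finset.mem_univ k)
  have hmi : ∀ i j, Integrable (m i j) γ := by
    intro i j
    refine Integrable.of_bound (hmm i j).aestronglyMeasurable 1 (Filter.Eventually.of_forall fun t => ?_)
    have h1 := hle t i
    have h2 := hle t j
    have h3 : |(σ i ^ (2 * K) * t i) * (σ j ^ (2 * K) * t j)| ≤ S t := by
      rw [abs_le]
      constructor <;> nlinarith [sq_nonneg (σ i ^ (2 * K) * t i + σ j ^ (2 * K) * t j),
        sq_nonneg (σ i ^ (2 * K) * t i - σ j ^ (2 * K) * t j)]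
    simp only [m]
    rw [norm_mul, Real.norm_eq_abs, Real.norm_eq_abs, abs_inv, abs_of_nonneg (hS0 t)]
    exact inv_mul_le_one_of_le₀ h3 (hS0 t)
  have hoff : ∀ i j, i ≠ j → ∫ t, m i j t ∂γ = 0 := by
    intro i j hij
    apply fd_off _ (hmm i j) i
    intro t
    have : S (fun k => if k = i then - t k else t k) = S t := by
      rw [hS, hS]
      refine Finset.sum_congr rfl fun k _ => ?_
      by_cases hk : k = i <;> simp [hk]
    simp only [m, this, if_true, if_neg hij.symm]
    ring
  have hdiag : ∀ k, ε * ∫ t, m k k t ∂γ = 1 - μ k := by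
    intro k
    rw [hμ]
    have : m k k = fun t => σ k ^ (4 * K) * t k ^ 2 / S t := by
      ext t
      simp only [m]
      rw [← hsq, div_eq_inv_mul, sq]
    rw [this]; ring
  let B : Fin c → Fin c → Matrix (Fin n) (Fin c) ℝ := fun i j =>
    ε • (U₁ * Matrix.diagonal σ * Matrix.single i j (1:ℝ) * U₂ᵀ)
  have key : ∀ t, V * (1 - ε • P t) = V - ∑ i, ∑ j, m i j t • B i j := by
    intro t
    have hM : (S t)⁻¹ • (Matrix.diagonal (fun j => σ j ^ (2 * K)) * Matrix.vecMulVec t t *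
        Matrix.diagonal (fun j => σ j ^ (2 * K))) = ∑ i, ∑ j, m i j t • Matrix.single i j (1:ℝ) := by
      conv_lhs => rw [Matrix.matrix_eq_sum_single ((S t)⁻¹ • (Matrix.diagonal (fun j => σ j ^ (2 * K)) * Matrix.vecMulVec t t *
        Matrix.diagonal (fun j => σ j ^ (2 * K))))]
      refine Finset.sum_congr rfl fun i _ => Finset.sum_congr rfl fun j _ => ?_
      rw [Matrix.smul_single]
      congr 1
      simp only [m, Matrix.smul_apply, Matrix.mul_diagonal, Matrix.diagonal_mul, Matrix.vecMulVec_apply, smul_eq_mul, mul_one]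
      ring
    have hVP : V * (ε • P t) = ε • (U₁ * Matrix.diagonal σ * ((S t)⁻¹ • (Matrix.diagonal (fun j => σ j ^ (2 * K)) * Matrix.vecMulVec t t *
        Matrix.diagonal (fun j => σ j ^ (2 * K)))) * U₂ᵀ) := by
      rw [hV, hP]
      simp only [Matrix.mul_smul, Matrix.smul_mul]
      congr 2
      simp only [Matrix.mul_assoc]
      rw [← Matrix.mul_assoc U₂ᵀ U₂, hU₂, Matrix.one_mul]
    rw [Matrix.mul_sub, Matrix.mul_one, hVP, hM]
    simp only [B, Matrix.mul_sum, Matrix.sum_mul, Finset.smul_sum, Matrix.mul_smul, Matrix.smul_mul]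
    simp only [smul_comm ε]
  simp only [key]
  haveI : CompleteSpace (Matrix (Fin n) (Fin c) ℝ) := FiniteDimensional.complete ℝ _
  refine (fd_gen γ m hmi V B).trans ?_
  have hrow : ∀ i, ∑ j, (∫ t, m i j t ∂γ) • B i j =
      U₁ * Matrix.diagonal σ * ((1 - μ i) • Matrix.single i i (1:ℝ)) * U₂ᵀ := by
    intro i
    rw [Finset.sum_eq_single i]
    · rw [← hdiag]
      simp only [B, Matrix.mul_smul, Matrix.smul_mul, smul_smul]
      rw [mul_comm]
    · intro j _ hj
      rw [hoff i j hj.symm, zero_smul]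
    · simp
  simp only [hrow]
  rw [← Matrix.sum_mul, ← Matrix.mul_sum]
  have hd : ∑ i, (1 - μ i) • Matrix.single i i (1:ℝ) = 1 - Matrix.diagonal μ := by
    rw [← Matrix.diagonal_one, Matrix.diagonal_sub, ← Matrix.sum_single_eq_diagonal]
    simp [Matrix.smul_single]
  rw [hd, hV]
  simp [Matrix.mul_sub, Matrix.sub_mul]
end

section
/- Let c ≥ 2 and K be positive integers, let σ₁, …, σ_c be strictly positive reals, let ε ∈ (0,1), set S(t) = ∑_{j=1}^c σ_j^{4K} t_j², and define μ_k = 1 − ε ∫ σ_k^{4K} t_k² / S(t) dγ(t) (the integrand set to 0 when S(t) = 0). Then for any two indices k₁, k₂ with σ_{k₁} ≤ σ_{k₂}, one has μ_{k₁} ≥ μ_{k₂}; equivalently, ∫ σ_{k₁}^{4K} t_{k₁}² / S(t) dγ(t) ≤ ∫ σ_{k₂}^{4K} t_{k₂}² / S(t) dγ(t). In particular, if σ₁ ≥ σ₂ ≥ ⋯ ≥ σ_c then μ₁ ≤ μ₂ ≤ ⋯ ≤ μ_c. -/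
open MeasureTheory ProbabilityTheory

lemma aux_key {c : ℕ} (w : Fin c → ℝ) (hw : ∀ j, 0 < w j) (k₁ k₂ : Fin c) (h : w k₁ ≤ w k₂) :
    (∫ t : Fin c → ℝ, w k₁ * t k₁ ^ 2 / (∑ j, w j * t j ^ 2)
        ∂(Measure.pi fun _ : Fin c => gaussianReal 0 1)) ≤
      ∫ t : Fin c → ℝ, w k₂ * t k₂ ^ 2 / (∑ j, w j * t j ^ 2)
        ∂(Measure.pi fun _ : Fin c => gaussianReal 0 1) := by
  have hnn : ∀ (t : Fin c → ℝ) j, 0 ≤ w j * t j ^ 2 := fun t j =>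
    mul_nonneg (hw j).le (sq_nonneg _)
  have hle : ∀ (t : Fin c → ℝ) k, w k * t k ^ 2 ≤ ∑ j, w j * t j ^ 2 := fun t k =>
    Finset.single_le_sum (f := fun j => w j * t j ^ 2) (fun j _ => hnn t j) (Finset.mem_univ k)
  have hmeas : ∀ k, Measurable fun t : Fin c → ℝ => w k * t k ^ 2 / (∑ j, w j * t j ^ 2) := by
    intro k; fun_prop
  have hint : ∀ k, Integrable (fun t : Fin c → ℝ => w k * t k ^ 2 / (∑ j, w j * t j ^ 2))
      (Measure.pi fun _ : Fin c => gaussianReal 0 1) := by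
    intro k
    refine Integrable.of_bound (hmeas k).aestronglyMeasurable 1 (ae_of_all _ fun t => ?_)
    have h0 : 0 ≤ ∑ j, w j * t j ^ 2 := Finset.sum_nonneg fun j _ => hnn t j
    rw [Real.norm_of_nonneg (div_nonneg (hnn t k) h0)]
    exact div_le_one_of_le₀ (hle t k) h0
  let e : Equiv.Perm (Fin c) := Equiv.swap k₁ k₂
  have hmp : MeasurePreserving (fun t : Fin c → ℝ => fun j => t (e j))
      (Measure.pi fun _ : Fin c => gaussianReal 0 1)
      (Measure.pi fun _ : Fin c => gaussianReal 0 1) := by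
    have := measurePreserving_piCongrLeft (α := fun _ : Fin c => ℝ)
      (fun _ : Fin c => gaussianReal 0 1) e
    convert this using 1
    funext t j
    have h2 := MeasurableEquiv.piCongrLeft_apply_apply (β := fun _ : Fin c => ℝ) e t (e j)
    simp only [e, Equiv.swap_apply_self, Equiv.swap_swap] at h2 ⊢
    exact h2.symm
  have hI : ∀ k, Integrable (fun t : Fin c → ℝ => w k * t (e k) ^ 2 / (∑ j, w j * t (e j) ^ 2))
      (Measure.pi fun _ : Fin c => gaussianReal 0 1) := fun k =>
    hmp.integrable_comp_of_integrable (hint k)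
  have heq : (∫ t : Fin c → ℝ, w k₁ * t k₁ ^ 2 / (∑ j, w j * t j ^ 2)
        ∂(Measure.pi fun _ : Fin c => gaussianReal 0 1)) =
      ∫ t : Fin c → ℝ, w k₁ * t (e k₁) ^ 2 / (∑ j, w j * t (e j) ^ 2)
        ∂(Measure.pi fun _ : Fin c => gaussianReal 0 1) := by
    conv_lhs => rw [← hmp.map_eq]
    exact integral_map hmp.measurable.aemeasurable (hmeas k₁).aestronglyMeasurable
  rw [heq]
  refine integral_mono (hI k₁) (hint k₂) fun t => ?_
  have he1 : e k₁ = k₂ := Equiv.swap_apply_left _ _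
  have he2 : e k₂ = k₁ := Equiv.swap_apply_right _ _
  have hS' : ∑ j, w j * t (e j) ^ 2 = ∑ j, w (e j) * t j ^ 2 := by
    rw [← Equiv.sum_comp e]
    refine Finset.sum_congr rfl fun j _ => ?_
    simp [e]
  simp only [he1]
  by_cases hy : t k₂ = 0
  · simp [hy]
  have hy2 : 0 < t k₂ ^ 2 := by positivity
  have hpos : 0 < ∑ j, w j * t j ^ 2 := lt_of_lt_of_le (mul_pos (hw _) hy2) (hle t k₂)
  have hpos' : 0 < ∑ j, w j * t (e j) ^ 2 := by
    have := hle (fun j => t (e j)) k₁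
    simp only [he1] at this
    exact lt_of_lt_of_le (mul_pos (hw _) hy2) this
  have hmain : w k₁ * ∑ j, w j * t j ^ 2 ≤ w k₂ * ∑ j, w j * t (e j) ^ 2 := by
    rw [hS', Finset.mul_sum, Finset.mul_sum]
    refine Finset.sum_le_sum fun j _ => ?_
    rw [← mul_assoc, ← mul_assoc]
    refine mul_le_mul_of_nonneg_right ?_ (sq_nonneg _)
    by_cases h1 : j = k₁
    · subst h1; rw [he1]; nlinarith [hw j, hw k₂]
    by_cases h2 : j = k₂
    · subst h2; rw [he2]; nlinarith
    rw [show e j = j from Equiv.swap_apply_of_ne_of_ne h1 h2]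
    exact mul_le_mul_of_nonneg_right h (hw j).le
  rw [div_le_div_iff₀ hpos' hpos]
  nlinarith [mul_le_mul_of_nonneg_left hmain hy2.le]

theorem mu_monotone (c K : ℕ) (hc : 2 ≤ c) (hK : 0 < K)
    (σ : Fin c → ℝ) (hσ : ∀ j, 0 < σ j)
    (ε : ℝ) (hε : ε ∈ Set.Ioo (0 : ℝ) 1)
    (S : (Fin c → ℝ) → ℝ) (hS : ∀ t, S t = ∑ j, σ j ^ (4 * K) * t j ^ 2)
    (μ : Fin c → ℝ)
    (hμ : ∀ k, μ k = 1 - ε * ∫ t : Fin c → ℝ, σ k ^ (4 * K) * t k ^ 2 / S t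
        ∂(Measure.pi fun _ : Fin c => gaussianReal 0 1)) :
    (∀ k₁ k₂ : Fin c, σ k₁ ≤ σ k₂ →
        μ k₂ ≤ μ k₁ ∧
          (∫ t : Fin c → ℝ, σ k₁ ^ (4 * K) * t k₁ ^ 2 / S t
              ∂(Measure.pi fun _ : Fin c => gaussianReal 0 1)) ≤
            ∫ t : Fin c → ℝ, σ k₂ ^ (4 * K) * t k₂ ^ 2 / S t
              ∂(Measure.pi fun _ : Fin c => gaussianReal 0 1)) ∧
      (Antitone σ → Monotone μ) := by
  have hfun : S = fun t => ∑ j, σ j ^ (4 * K) * t j ^ 2 := funext hS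
  subst hfun
  have key : ∀ k₁ k₂ : Fin c, σ k₁ ≤ σ k₂ → _ := fun k₁ k₂ h =>
    aux_key (fun j => σ j ^ (4 * K)) (fun j => pow_pos (hσ j) _) k₁ k₂
      (pow_le_pow_left₀ (hσ k₁).le h _)
  have hm : ∀ k₁ k₂ : Fin c, σ k₁ ≤ σ k₂ → μ k₂ ≤ μ k₁ := by
    intro k₁ k₂ h
    rw [hμ, hμ]
    exact sub_le_sub_left (mul_le_mul_of_nonneg_left (key k₁ k₂ h) hε.1.le) _
  exact ⟨fun k₁ k₂ h => ⟨hm k₁ k₂ h, key k₁ k₂ h⟩, fun ha i j hij => hm _ _ (ha hij)⟩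
end
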